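/- Let H be a real N×d matrix with N ≤ d, and set C = HᵀH/N, assumed to have trace 1 (i.e., the squared Frobenius norm of H equals N). If the von Neumann entropy S(C) attains its maximal possible value log N, then H·Hᵀ = I_N, the N×N identity matrix; that is, the rows of H are pairwise orthogonal unit vectors. -/

import Mathlib

open Matrix

lemma Real.negMulLog_le_inv_sub_add_mul_log {x n : ℝ} (hx : 0 < x) (hn : 0 < n) :
    Real.negMulLog x ≤ n⁻¹ - x + x * Real.log n := by
  have h := Real.log_le_sub_one_of_pos (x := (n * x)⁻¹) (by positivity)
  rw [Real.log_inv, Real.log_mul hn.ne' hx.ne'] at h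
  have h' := mul_le_mul_of_nonneg_left h hx.le
  have e : x * ((n * x)⁻¹ - 1) = n⁻¹ - x := by field_simp
  rw [e] at h'
  rw [Real.negMulLog]
  linarith

lemma Real.eq_inv_of_negMulLog_eq {x n : ℝ} (hx : 0 < x) (hn : 0 < n)
    (h : Real.negMulLog x = n⁻¹ - x + x * Real.log n) : x = n⁻¹ := by
  by_contra hne
  have hne' : (n * x)⁻¹ ≠ 1 := by
    rw [Ne, inv_eq_one, mul_comm]
    exact fun h1 => hne (eq_inv_of_mul_eq_one_left h1)
  have hlt := Real.log_lt_sub_one_of_pos (x := (n * x)⁻¹) (by positivity) hne'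
  rw [Real.log_inv, Real.log_mul hn.ne' hx.ne'] at hlt
  have h' := mul_lt_mul_of_pos_left hlt hx
  have e : x * ((n * x)⁻¹ - 1) = n⁻¹ - x := by field_simp
  rw [e] at h'
  rw [Real.negMulLog] at h
  linarith

/-- A probability vector supported on at most `n` points whose Shannon entropy is `log n` is
uniform on a set of exactly `n` points. -/
lemma uniform_of_sum_negMulLog_eq_log {ι : Type*} [Fintype ι] {p : ι → ℝ} {n : ℕ}
    (hn : 0 < n) (hp : ∀ i, 0 ≤ p i) (hsum : ∑ i, p i = 1)
    (hcard : (Finset.univ.filter fun i => p i ≠ 0).card ≤ n)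
    (hent : ∑ i, Real.negMulLog (p i) = Real.log n) :
    (∀ i, p i = 0 ∨ p i = (n : ℝ)⁻¹) ∧ (Finset.univ.filter fun i => p i ≠ 0).card = n := by
  have hn' : (0 : ℝ) < n := by exact_mod_cast hn
  set s := Finset.univ.filter fun i => p i ≠ 0 with hs
  have hpos : ∀ i ∈ s, 0 < p i := fun i hi =>
    (hp i).lt_of_ne' (Finset.mem_filter.mp hi).2
  have hsum' : ∑ i ∈ s, p i = 1 := by rw [hs, Finset.sum_filter_ne_zero, hsum]
  have hent' : ∑ i ∈ s, Real.negMulLog (p i) = Real.log n := by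
    rw [← hent]
    refine Finset.sum_subset (Finset.subset_univ s) fun i _ hi => ?_
    have h0 : p i = 0 := by simpa [hs] using hi
    simp [h0]
  have hle : ∀ i ∈ s, Real.negMulLog (p i) ≤ (n : ℝ)⁻¹ - p i + p i * Real.log n :=
    fun i hi => Real.negMulLog_le_inv_sub_add_mul_log (hpos i hi) hn'
  have htot : ∑ i ∈ s, ((n : ℝ)⁻¹ - p i + p i * Real.log n)
      = s.card * (n : ℝ)⁻¹ - 1 + Real.log n := by
    rw [Finset.sum_add_distrib, Finset.sum_sub_distrib, ← Finset.sum_mul, hsum']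
    simp
  have hcard' : (s.card : ℝ) * (n : ℝ)⁻¹ ≤ 1 := by
    rw [← div_eq_mul_inv, div_le_one hn']
    exact_mod_cast hcard
  have hbound := Finset.sum_le_sum hle
  have hone : (s.card : ℝ) * (n : ℝ)⁻¹ = 1 := by
    rw [htot, hent'] at hbound
    linarith
  have heq := (Finset.sum_eq_sum_iff_of_le hle).mp (by rw [htot, hent', hone]; ring)
  refine ⟨fun i => or_iff_not_imp_left.mpr fun hi => ?_, ?_⟩
  · have hi' : i ∈ s := by simpa [hs] using hi
    exact Real.eq_inv_of_negMulLog_eq (hpos i hi') hn' (heq i hi')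
  · rw [← div_eq_mul_inv, div_eq_one_iff_eq hn'.ne'] at hone
    exact_mod_cast hone

lemma Matrix.IsHermitian.mul_self_eq_smul_of_eigenvalues {m : Type*} [Fintype m] [DecidableEq m]
    {A : Matrix m m ℝ} (hA : A.IsHermitian) {c : ℝ}
    (h : ∀ i, hA.eigenvalues i = 0 ∨ hA.eigenvalues i = c) : A * A = c • A := by
  have hdiag : diagonal (RCLike.ofReal ∘ hA.eigenvalues : m → ℝ) * diagonal (RCLike.ofReal ∘ hA.eigenvalues)
      = c • diagonal (RCLike.ofReal ∘ hA.eigenvalues : m → ℝ) := by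
    rw [diagonal_mul_diagonal, ← diagonal_smul]
    congr 1
    ext i
    rcases h i with hi | hi <;> simp [hi]
  have hspec := hA.spectral_theorem
  have := congrArg (Unitary.conjStarAlgAut ℝ _ hA.eigenvectorUnitary) hdiag
  rwa [map_mul, map_smul, ← hspec] at this

/-- **Isotropy and VNE.**
Let `H` be a real `N × d` matrix with `N ≤ d` and let `C = Hᵀ H / N` have trace `1`
(i.e. the squared Frobenius norm of `H` equals `N`).  If the von Neumann entropy
`S(C)` attains its maximal possible value `log N`, then `H Hᵀ = I_N`, i.e. the rows
of `H` are pairwise orthogonal unit vectors. -/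
theorem maximal_vne_implies_isotropy (N d : ℕ) (hNd : N ≤ d)
    (H : Matrix (Fin N) (Fin d) ℝ)
    (hC : (((N : ℝ)⁻¹) • (Hᵀ * H)).IsHermitian)
    (htr : (((N : ℝ)⁻¹) • (Hᵀ * H)).trace = 1)
    (hent : -∑ j, hC.eigenvalues j * Real.log (hC.eigenvalues j) = Real.log N) :
    H * Hᵀ = (1 : Matrix (Fin N) (Fin N) ℝ) := by
  have hN : 0 < N := by
    rcases Nat.eq_zero_or_pos N with rfl | h
    · simp at htr
    · exact h
  have hN' : (N : ℝ) ≠ 0 := by exact_mod_cast hN.ne'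
  have hrankC : (((N : ℝ)⁻¹) • (Hᵀ * H)).rank = H.rank := by
    rw [rank_smul_of_mem_nonZeroDivisors _ (mem_nonZeroDivisors_of_ne_zero (inv_ne_zero hN')), rank_transpose_mul_self]
  have hrank : (Finset.univ.filter fun j => hC.eigenvalues j ≠ 0).card = H.rank := by
    rw [← hrankC, hC.rank_eq_card_non_zero_eigs, Fintype.card_subtype]
  have hpsd : (((N : ℝ)⁻¹) • (Hᵀ * H)).PosSemidef := by
    have h := posSemidef_conjTranspose_mul_self H
    rw [conjTranspose_eq_transpose_of_trivial] at h
    exact h.smul (by positivity)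
  have hsum : ∑ j, hC.eigenvalues j = 1 := by
    rw [← htr, hC.trace_eq_sum_eigenvalues]
    simp
  obtain ⟨heig, hcard⟩ := uniform_of_sum_negMulLog_eq_log hN hpsd.eigenvalues_nonneg hsum
    (hrank.trans_le (by simpa using H.rank_le_height))
    (by simpa [Real.negMulLog] using hent)
  have hidem : Hᵀ * H * (Hᵀ * H) = Hᵀ * H := by
    have h := hC.mul_self_eq_smul_of_eigenvalues heig
    rw [smul_mul_smul_comm, smul_smul] at h
    exact smul_right_injective _ (mul_ne_zero (inv_ne_zero hN') (inv_ne_zero hN')) h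
  have hunit : IsUnit (H * Hᵀ) := by
    rw [← linearIndependent_rows_iff_isUnit, linearIndependent_iff_card_eq_finrank_span,
      Set.finrank, ← rank_eq_finrank_span_row, rank_self_mul_transpose, ← hrank, hcard,
      Fintype.card_fin]
  have hcube : H * Hᵀ * (H * Hᵀ) * (H * Hᵀ) = H * Hᵀ * (H * Hᵀ) * 1 := by
    calc H * Hᵀ * (H * Hᵀ) * (H * Hᵀ) = H * (Hᵀ * H * (Hᵀ * H)) * Hᵀ := by
          simp only [Matrix.mul_assoc]
      _ = H * Hᵀ * (H * Hᵀ) * 1 := by rw [hidem]; simp only [Matrix.mul_assoc, Matrix.mul_one]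
  exact (hunit.mul hunit).mul_left_cancel hcube
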